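/- Let H be a Hopf algebra over a commutative ring k, with adjoint R-matrix R_H(x⊗y) = y⁽¹⁾⊗S(y⁽²⁾)xy⁽³⁾. Let (ξ, ζ, S') be a normalized Hopf 2-cocycle with deformed antipode: ξ : H⊗H → H, ζ : H → H⊗H, S' : H → H linear maps such that (i) μ(ξ⊗1) + ξ(μ⊗1) = μ(1⊗ξ) + ξ(1⊗μ); (ii) (ζ⊗1)Δ + (Δ⊗1)ζ = (1⊗ζ)Δ + (1⊗Δ)ζ; (iii) ζμ + Δξ = (μ⊗μ)(1⊗t⊗1)(ζ⊗Δ + Δ⊗ζ) + (ξ⊗μ + μ⊗ξ)(1⊗t⊗1)(Δ⊗Δ), where t is the flip x⊗y ↦ y⊗x; (iv) normalization: ξ(1⊗x) = ξ(x⊗1) = 0 and (ε⊗1)ζ = (1⊗ε)ζ = 0; (v) μ(1⊗S')Δ + μ(1⊗S)ζ + ξ(1⊗S)Δ = 0. Define Ψ_ζ(ξ) : H⊗H → H⊗H by Ψ_ζ(ξ)(x⊗y) = y⁽¹⁾⊗S(y⁽²⁾)ξ(x⊗y⁽³⁾) + y⁽¹⁾⊗ξ(S(y⁽²⁾)⊗xy⁽³⁾)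 + ₍₁₎y⊗S(₍₂₎y)x₍₃₎y + ⁽¹⁾y⊗S(⁽²⁾y)x⁽³⁾y + y⁽¹⁾⊗S'(y⁽²⁾)xy⁽³⁾, where ₍₁₎y⊗₍₂₎y⊗₍₃₎y = (1⊗Δ)ζ(y) and ⁽¹⁾y⊗⁽²⁾y⊗⁽³⁾y = (1⊗ζ)Δ(y). Then the braided-commutativity component vanishes: μ∘Ψ_ζ(ξ) + ξ∘R_H − ξ = 0. -/

import Mathlib

open TensorProduct LinearMap


noncomputable section

variable (k : Type*) [CommRing k] (H : Type*) [Ring H] [HopfAlgebra k H]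

/-- The iterated comultiplication `y ↦ y⁽¹⁾ ⊗ y⁽²⁾ ⊗ y⁽³⁾`. -/
def comul₂ : H →ₗ[k] (H ⊗[k] H) ⊗[k] H :=
  (Coalgebra.comul (R := k) (A := H)).rTensor H ∘ₗ Coalgebra.comul (R := k) (A := H)

/-- The transposition of the last two factors of a four-fold tensor product. -/
def swapLast : ((H ⊗[k] H) ⊗[k] H) ⊗[k] H →ₗ[k] ((H ⊗[k] H) ⊗[k] H) ⊗[k] H :=
  (TensorProduct.assoc k (H ⊗[k] H) H H).symm.toLinearMap ∘ₗ
    (TensorProduct.comm k H H).toLinearMap.lTensor (H ⊗[k] H) ∘ₗ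
    (TensorProduct.assoc k (H ⊗[k] H) H H).toLinearMap

/-- Given `c : H → H⊗H⊗H`, `y ↦ y_I ⊗ y_{II} ⊗ y_{III}`, and `s : H → H`, the
map `x ⊗ y ↦ y_I ⊗ s(y_{II}) x y_{III}`. -/
def adjCore (c : H →ₗ[k] (H ⊗[k] H) ⊗[k] H) (s : H →ₗ[k] H) :
    H ⊗[k] H →ₗ[k] H ⊗[k] H :=
  (LinearMap.mul' k H).lTensor H ∘ₗ (TensorProduct.assoc k H H H).toLinearMap ∘ₗ
    (((LinearMap.mul' k H).lTensor H ∘ₗ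
        (TensorProduct.assoc k H H H).toLinearMap).rTensor H) ∘ₗ
    swapLast k H ∘ₗ
    ((((s.lTensor H).rTensor H) ∘ₗ c).rTensor H) ∘ₗ
    (TensorProduct.comm k H H).toLinearMap

/-- The adjoint R-matrix `R_H(x ⊗ y) = y⁽¹⁾ ⊗ S(y⁽²⁾) x y⁽³⁾` of a Hopf
algebra. -/
def adjR : H ⊗[k] H →ₗ[k] H ⊗[k] H :=
  adjCore k H (comul₂ k H) (HopfAlgebra.antipode (R := k) (A := H))

variable {k H}

/-- The map `x ⊗ y ↦ ((y⁽¹⁾ ⊗ s(y⁽²⁾)) ⊗ y⁽³⁾) ⊗ x`. -/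
def hopfPref (c : H →ₗ[k] (H ⊗[k] H) ⊗[k] H) (s : H →ₗ[k] H) :
    H ⊗[k] H →ₗ[k] ((H ⊗[k] H) ⊗[k] H) ⊗[k] H :=
  ((((s.lTensor H).rTensor H) ∘ₗ c).rTensor H) ∘ₗ
    (TensorProduct.comm k H H).toLinearMap

/-- The term `x ⊗ y ↦ y⁽¹⁾ ⊗ S(y⁽²⁾) ξ(x ⊗ y⁽³⁾)`. -/
def psiTerm1 (ξ : H ⊗[k] H →ₗ[k] H) : H ⊗[k] H →ₗ[k] H ⊗[k] H :=
  (LinearMap.mul' k H).lTensor H ∘ₗ (TensorProduct.assoc k H H H).toLinearMap ∘ₗ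
    ((ξ ∘ₗ (TensorProduct.comm k H H).toLinearMap).lTensor (H ⊗[k] H)) ∘ₗ
    (TensorProduct.assoc k (H ⊗[k] H) H H).toLinearMap ∘ₗ
    hopfPref (comul₂ k H) (HopfAlgebra.antipode (R := k) (A := H))

/-- The term `x ⊗ y ↦ y⁽¹⁾ ⊗ ξ(S(y⁽²⁾) ⊗ x y⁽³⁾)`. -/
def psiTerm2 (ξ : H ⊗[k] H →ₗ[k] H) : H ⊗[k] H →ₗ[k] H ⊗[k] H :=
  ξ.lTensor H ∘ₗ (TensorProduct.assoc k H H H).toLinearMap ∘ₗ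
    ((LinearMap.mul' k H ∘ₗ (TensorProduct.comm k H H).toLinearMap).lTensor
      (H ⊗[k] H)) ∘ₗ
    (TensorProduct.assoc k (H ⊗[k] H) H H).toLinearMap ∘ₗ
    hopfPref (comul₂ k H) (HopfAlgebra.antipode (R := k) (A := H))

/-- The map `Ψ_ζ(ξ)` of Saito–Zappala. -/
def PsiMap (ξ : H ⊗[k] H →ₗ[k] H) (ζ : H →ₗ[k] H ⊗[k] H) (S' : H →ₗ[k] H) :
    H ⊗[k] H →ₗ[k] H ⊗[k] H :=
  psiTerm1 ξ + psiTerm2 ξ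
    + adjCore k H ((TensorProduct.assoc k H H H).symm.toLinearMap ∘ₗ
        (Coalgebra.comul (R := k) (A := H)).lTensor H ∘ₗ ζ)
      (HopfAlgebra.antipode (R := k) (A := H))
    + adjCore k H ((TensorProduct.assoc k H H H).symm.toLinearMap ∘ₗ
        ζ.lTensor H ∘ₗ Coalgebra.comul (R := k) (A := H))
      (HopfAlgebra.antipode (R := k) (A := H))
    + adjCore k H (comul₂ k H) S'

/-- `μ ∘ adjCore c s` at `x ⊗ y` is `y_I s(y_{II}) (x y_{III})`. -/
lemma mul'_adjCore (c : H →ₗ[k] (H ⊗[k] H) ⊗[k] H) (s : H →ₗ[k] H) (x y : H) :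
    LinearMap.mul' k H (adjCore k H c s (x ⊗ₜ[k] y)) =
      LinearMap.mul' k H (TensorProduct.map (LinearMap.mul' k H ∘ₗ s.lTensor H)
        (LinearMap.mulLeft k x) (c y)) := by
  simp only [adjCore, swapLast, LinearMap.comp_apply, LinearEquiv.coe_coe,
    TensorProduct.comm_tmul, rTensor_tmul]
  generalize c y = t
  induction t using TensorProduct.induction_on with
  | zero => simp
  | add a b ha hb => simp only [map_add, TensorProduct.add_tmul, ha, hb]
  | tmul u z =>
    induction u using TensorProduct.induction_on with
    | zero => simp
    | add a b ha hb => simp only [map_add, TensorProduct.add_tmul, ha, hb]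
    | tmul a b => simp [mul_assoc]

/-- `μ ∘ psiTerm1 ξ` at `x ⊗ y` is `y⁽¹⁾ S(y⁽²⁾) ξ(x ⊗ y⁽³⁾)`. -/
lemma mul'_psiTerm1 (ξ : H ⊗[k] H →ₗ[k] H) (x y : H) :
    LinearMap.mul' k H (psiTerm1 ξ (x ⊗ₜ[k] y)) =
      LinearMap.mul' k H (TensorProduct.map
        (LinearMap.mul' k H ∘ₗ (HopfAlgebra.antipode (R := k) (A := H)).lTensor H)
        (ξ ∘ₗ TensorProduct.mk k H H x) (comul₂ k H y)) := by
  simp only [psiTerm1, hopfPref, LinearMap.comp_apply, LinearEquiv.coe_coe,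
    TensorProduct.comm_tmul, rTensor_tmul]
  generalize comul₂ k H y = t
  induction t using TensorProduct.induction_on with
  | zero => simp
  | add a b ha hb => simp only [map_add, TensorProduct.add_tmul, ha, hb]
  | tmul u z =>
    induction u using TensorProduct.induction_on with
    | zero => simp
    | add a b ha hb => simp only [map_add, TensorProduct.add_tmul, ha, hb]
    | tmul a b => simp [mul_assoc]

/-- The Hochschild cocycle identity at `y⁽¹⁾ ⊗ S(y⁽²⁾) ⊗ x y⁽³⁾`. -/
lemma mul'_psiTerm2_add_adjR (ξ : H ⊗[k] H →ₗ[k] H)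
    (hxi : LinearMap.mul' k H ∘ₗ ξ.rTensor H + ξ ∘ₗ (LinearMap.mul' k H).rTensor H =
      LinearMap.mul' k H ∘ₗ ξ.lTensor H ∘ₗ (TensorProduct.assoc k H H H).toLinearMap +
        ξ ∘ₗ (LinearMap.mul' k H).lTensor H ∘ₗ (TensorProduct.assoc k H H H).toLinearMap)
    (x y : H) :
    LinearMap.mul' k H (psiTerm2 ξ (x ⊗ₜ[k] y)) + ξ (adjR k H (x ⊗ₜ[k] y)) =
      LinearMap.mul' k H (TensorProduct.map
        (ξ ∘ₗ (HopfAlgebra.antipode (R := k) (A := H)).lTensor H)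
        (LinearMap.mulLeft k x) (comul₂ k H y)) +
      ξ (TensorProduct.map
        (LinearMap.mul' k H ∘ₗ (HopfAlgebra.antipode (R := k) (A := H)).lTensor H)
        (LinearMap.mulLeft k x) (comul₂ k H y)) := by
  simp only [psiTerm2, adjR, adjCore, swapLast, hopfPref, LinearMap.comp_apply,
    LinearEquiv.coe_coe, TensorProduct.comm_tmul, rTensor_tmul]
  generalize comul₂ k H y = t
  induction t using TensorProduct.induction_on with
  | zero => simp
  | add a b ha hb =>
    simp only [map_add, TensorProduct.add_tmul]
    rw [add_add_add_comm, ha, hb, add_add_add_comm]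
  | tmul u z =>
    induction u using TensorProduct.induction_on with
    | zero => simp
    | add a b ha hb =>
      simp only [map_add, TensorProduct.add_tmul]
      rw [add_add_add_comm, ha, hb, add_add_add_comm]
    | tmul a b =>
      have h := LinearMap.congr_fun hxi
        ((a ⊗ₜ[k] HopfAlgebra.antipode (R := k) b) ⊗ₜ[k] (x * z))
      simpa [mul_assoc] using h.symm

/-- The antipode axiom in the first leg: `a⁽¹⁾ S(a⁽²⁾) ⊗ g(b) = 1 ⊗ g(ε(a) b)`. -/
lemma map_mul'_antipode_rTensor_comul (g : H →ₗ[k] H) (t : H ⊗[k] H) :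
    TensorProduct.map
        (LinearMap.mul' k H ∘ₗ (HopfAlgebra.antipode (R := k) (A := H)).lTensor H) g
        ((Coalgebra.comul (R := k) (A := H)).rTensor H t) =
      (1 : H) ⊗ₜ[k] g (TensorProduct.lid k H
        ((Coalgebra.counit (R := k) (A := H)).rTensor H t)) := by
  induction t using TensorProduct.induction_on with
  | zero => simp
  | add a b ha hb => simp only [map_add, TensorProduct.tmul_add, ha, hb]
  | tmul a b =>
    simp [HopfAlgebra.mul_antipode_lTensor_comul_apply, Algebra.algebraMap_eq_smul_one,
      TensorProduct.smul_tmul]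

/-- for a normalized Hopf 2-cocycle `(ξ, ζ)` with deformed
antipode `S'`, the braided-commutativity component vanishes on the image of
the map `Ψ`:  `μ ∘ Ψ_ζ(ξ) + ξ ∘ R_H − ξ = 0`. -/
theorem mu_PsiMap_braided_commutative {k : Type*} [CommRing k] {H : Type*}
    [Ring H] [HopfAlgebra k H]
    (ξ : H ⊗[k] H →ₗ[k] H) (ζ : H →ₗ[k] H ⊗[k] H) (S' : H →ₗ[k] H)
    -- (i) Hochschild 2-cocycle condition for ξ
    (hxi : LinearMap.mul' k H ∘ₗ ξ.rTensor H + ξ ∘ₗ (LinearMap.mul' k H).rTensor H =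
      LinearMap.mul' k H ∘ₗ ξ.lTensor H ∘ₗ (TensorProduct.assoc k H H H).toLinearMap +
        ξ ∘ₗ (LinearMap.mul' k H).lTensor H ∘ₗ (TensorProduct.assoc k H H H).toLinearMap)
    -- (ii) coHochschild 2-cocycle condition for ζ
    (hzeta : ζ.rTensor H ∘ₗ Coalgebra.comul (R := k) (A := H) +
        (Coalgebra.comul (R := k) (A := H)).rTensor H ∘ₗ ζ =
      (TensorProduct.assoc k H H H).symm.toLinearMap ∘ₗ ζ.lTensor H ∘ₗ
          Coalgebra.comul (R := k) (A := H) +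
        (TensorProduct.assoc k H H H).symm.toLinearMap ∘ₗ
          (Coalgebra.comul (R := k) (A := H)).lTensor H ∘ₗ ζ)
    -- (iii) compatibility of ξ and ζ
    (hcomp : ζ ∘ₗ LinearMap.mul' k H + Coalgebra.comul (R := k) (A := H) ∘ₗ ξ =
      TensorProduct.map (LinearMap.mul' k H) (LinearMap.mul' k H) ∘ₗ
          (TensorProduct.tensorTensorTensorComm k H H H H).toLinearMap ∘ₗ
          (TensorProduct.map ζ (Coalgebra.comul (R := k) (A := H)) +
            TensorProduct.map (Coalgebra.comul (R := k) (A := H)) ζ) +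
        (TensorProduct.map ξ (LinearMap.mul' k H) +
            TensorProduct.map (LinearMap.mul' k H) ξ) ∘ₗ
          (TensorProduct.tensorTensorTensorComm k H H H H).toLinearMap ∘ₗ
          TensorProduct.map (Coalgebra.comul (R := k) (A := H))
            (Coalgebra.comul (R := k) (A := H)))
    -- (iv) normalization
    (hnorm1 : ∀ x : H, ξ ((1 : H) ⊗ₜ[k] x) = 0)
    (hnorm2 : ∀ x : H, ξ (x ⊗ₜ[k] (1 : H)) = 0)
    (hnorm3 : (Coalgebra.counit (R := k) (A := H)).rTensor H ∘ₗ ζ = 0)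
    (hnorm4 : (Coalgebra.counit (R := k) (A := H)).lTensor H ∘ₗ ζ = 0)
    -- (v) deformed antipode condition
    (hS' : LinearMap.mul' k H ∘ₗ S'.lTensor H ∘ₗ Coalgebra.comul (R := k) (A := H) +
        LinearMap.mul' k H ∘ₗ (HopfAlgebra.antipode (R := k) (A := H)).lTensor H ∘ₗ ζ +
        ξ ∘ₗ (HopfAlgebra.antipode (R := k) (A := H)).lTensor H ∘ₗ
          Coalgebra.comul (R := k) (A := H) = 0) :
    LinearMap.mul' k H ∘ₗ PsiMap ξ ζ S' + ξ ∘ₗ adjR k H - ξ = 0 := by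
  refine TensorProduct.ext' fun x y => ?_
  have hz := congrArg (fun t => LinearMap.mul' k H (TensorProduct.map
    (LinearMap.mul' k H ∘ₗ (HopfAlgebra.antipode (R := k) (A := H)).lTensor H)
    (LinearMap.mulLeft k x) t)) (LinearMap.congr_fun hzeta y)
  have hs := congrArg (fun f => LinearMap.mul' k H (TensorProduct.map f
    (LinearMap.mulLeft k x) (Coalgebra.comul (R := k) y))) hS'
  have h3 := LinearMap.congr_fun hnorm3 y
  have hx := mul'_psiTerm2_add_adjR ξ hxi x y
  simp only [LinearMap.add_apply, map_add, LinearMap.comp_apply, LinearMap.zero_apply,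
    TensorProduct.map_add_left, TensorProduct.map_zero_left, map_zero] at hz hs h3
  rw [map_mul'_antipode_rTensor_comul, h3] at hz
  rw [comul₂, LinearMap.comp_apply, map_mul'_antipode_rTensor_comul, hnorm1] at hx
  simp only [PsiMap, LinearMap.add_apply, LinearMap.sub_apply, LinearMap.comp_apply, map_add,
    LinearMap.zero_apply, mul'_adjCore, mul'_psiTerm1]
  simp only [comul₂, LinearMap.comp_apply, map_mul'_antipode_rTensor_comul,
    Coalgebra.rTensor_counit_comul]
  simp only [LinearMap.map_rTensor, LinearMap.comp_assoc] at hz hx ⊢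
  simp only [map_zero, TensorProduct.tmul_zero, add_zero, LinearMap.mul'_apply, one_mul,
    TensorProduct.lid_tmul, one_smul, TensorProduct.mk_apply] at hz hx ⊢
  rw [← hx, hz] at hs
  rw [← hs]
  abel

end
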